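/- Uniqueness of Kummer data up to p-th powers (the gluing fact of §1.1, used in the proof of Proposition 4.8): if f and g are units of A such that f⁻¹·df = g⁻¹·dg in Ω¹_{A/k}, then there exists a unit h of A with f = h^p·g. -/

import Mathlib

/-!
Uniqueness of Kummer data up to `p`-th powers: two units with the same logarithmic
differential differ by the `p`-th power of a unit.
-/

universe u

/-!
The main point is that an element of a smooth algebra over a perfect field of characteristic `p`
with vanishing differential is a `p`-th power. Locally the algebra is spanned by products of
`p`-th powers and monomials in coordinates `x i`, which are eigenvectors of the Euler derivations
`x i * ∂/∂(x i)`; projecting onto the common kernel gives the result.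
-/

open scoped TensorProduct

/-- A finite unramified algebra of characteristic `p` all of whose `p`-th powers come from the
base is a quotient of the base. -/
theorem Algebra.FormallyUnramified.surjective_algebraMap_of_pow_mem_range
    {C B : Type*} [CommRing C] [CommRing B] [Algebra C B] [Module.Finite C B]
    [Algebra.FormallyUnramified C B] (p : ℕ) [Fact p.Prime] [CharP C p]
    (h : ∀ b : B, b ^ p ∈ (algebraMap C B).range) :
    Function.Surjective (algebraMap C B) := by
  rw [← Algebra.isEpi_iff_surjective_algebraMap_of_finite, Algebra.isEpi_iff_forall_one_tmul_eq]
  intro a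
  obtain ⟨t, ht, ht1⟩ := Algebra.FormallyUnramified.iff_exists_tensorProduct.mp
    ‹Algebra.FormallyUnramified C B›
  have hnil (s : B) : IsNilpotent ((1 : B) ⊗ₜ[C] s - s ⊗ₜ[C] (1 : B)) := by
    obtain ⟨c, hc⟩ := h s
    obtain ⟨r, hr⟩ := exists_add_pow_prime_eq (Fact.out : p.Prime)
      ((1 : B) ⊗ₜ[C] s - s ⊗ₜ[C] (1 : B)) (s ⊗ₜ[C] (1 : B))
    have hp : (p : B ⊗[C] B) = 0 := by
      rw [← map_natCast (algebraMap C (B ⊗[C] B)), CharP.cast_eq_zero, map_zero]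
    have hs : (1 : B) ⊗ₜ[C] (s ^ p) = (s ^ p) ⊗ₜ[C] (1 : B) := by
      rw [← hc, Algebra.algebraMap_eq_smul_one, TensorProduct.smul_tmul]
    refine ⟨p, ?_⟩
    simpa [hp, Algebra.TensorProduct.tmul_pow, hs] using hr
  have hle : KaehlerDifferential.ideal C B ≤ nilradical (B ⊗[C] B) := by
    rw [← KaehlerDifferential.span_range_eq_ideal, Ideal.span_le]
    rintro _ ⟨s, rfl⟩
    exact mem_nilradical.mpr (hnil s)
  have hunit : IsUnit t := by
    have : IsNilpotent (1 - t) := mem_nilradical.mp (hle (by simp [RingHom.mem_ker, ht1]))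
    simpa using this.isUnit_one_sub
  exact sub_eq_zero.mp (hunit.mul_left_eq_zero.mp (ht a))

/-- A monomial is an eigenvector of a derivation that rescales each of its variables. -/
theorem Derivation.apply_prod_pow_of_eigen {k A ι : Type*} [CommRing k] [CommRing A] [Algebra k A]
    (D : Derivation k A A) (x : ι → A) (c : ι → ℕ) (hc : ∀ j, D (x j) = c j * x j)
    (n : ι → ℕ) (s : Finset ι) :
    D (∏ j ∈ s, x j ^ n j) = (∑ j ∈ s, n j * c j : ℕ) * ∏ j ∈ s, x j ^ n j := by
  classical
  have hpow (j : ι) (m : ℕ) : D (x j ^ m) = (m * c j : ℕ) * x j ^ m := by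
    induction m with
    | zero => simp
    | succ m ih =>
      rw [pow_succ, Derivation.leibniz, ih, hc]
      simp only [smul_eq_mul]
      push_cast
      ring
  induction s using Finset.induction_on with
  | empty => simp
  | insert i s hi ih =>
    rw [Finset.prod_insert hi, Finset.sum_insert hi, Derivation.leibniz, ih, hpow]
    simp only [smul_eq_mul]
    push_cast
    ring

section Coordinates

variable {A ι k : Type*} [CommRing A] [Field k] [Algebra k A]

/-- The Euler derivation `x i * ∂/∂(x i)` attached to a basis of differentials. -/
noncomputable def eulerDerivation (x : ι → A) (b : Module.Basis ι A Ω[A⁄k]) (i : ι) :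
    Derivation k A A :=
  x i • (b.coord i).compDer (KaehlerDifferential.D k A)

theorem eulerDerivation_eq_zero (x : ι → A) (b : Module.Basis ι A Ω[A⁄k]) (i : ι) {a : A}
    (ha : KaehlerDifferential.D k A a = 0) : eulerDerivation x b i a = 0 := by
  simp [eulerDerivation, ha]

variable [Fintype ι]

/-- Products of a `p`-th power and a monomial in the family `x`. -/
def powMonomials (p : ℕ) (x : ι → A) : Submonoid A where
  carrier := {m | ∃ (b : A) (n : ι → ℕ), m = b ^ p * ∏ j, x j ^ n j}
  one_mem' := ⟨1, 0, by simp⟩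
  mul_mem' := by
    rintro _ _ ⟨b, n, rfl⟩ ⟨b', n', rfl⟩
    refine ⟨b * b', n + n', ?_⟩
    simp only [Pi.add_apply, pow_add, Finset.prod_mul_distrib]
    ring

theorem pow_mem_powMonomials (p : ℕ) (x : ι → A) (b : A) : b ^ p ∈ powMonomials p x :=
  ⟨b, 0, by simp⟩

theorem apply_mem_powMonomials (p : ℕ) (x : ι → A) (i : ι) : x i ∈ powMonomials p x := by
  classical
  exact ⟨1, Pi.single i 1, by simp [Pi.single_apply, pow_ite]⟩

variable (p : ℕ) [CharP k p]

/-- Products of `p`-th powers and monomials are eigenvectors of the Euler derivations. -/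
theorem eulerDerivation_powMonomial (x : ι → A)
    (b : Module.Basis ι A Ω[A⁄k]) (hb : ∀ i, b i = KaehlerDifferential.D k A (x i))
    (i : ι) (a : A) (n : ι → ℕ) :
    eulerDerivation x b i (a ^ p * ∏ j, x j ^ n j) = n i * (a ^ p * ∏ j, x j ^ n j) := by
  classical
  have hp : (p : A) = 0 := by
    rw [← map_natCast (algebraMap k A), CharP.cast_eq_zero, map_zero]
  have hx (j : ι) : eulerDerivation x b i (x j) = (if j = i then 1 else 0 : ℕ) * x j := by
    change x i * b.repr (KaehlerDifferential.D k A (x j)) i = _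
    rw [← hb, Module.Basis.repr_self, Finsupp.single_apply]
    split_ifs with h <;> simp [h]
  rw [Derivation.leibniz, Derivation.apply_prod_pow_of_eigen _ x _ hx, Derivation.leibniz_pow]
  simp [hp]
  ring

variable [Fact p.Prime]

/-- If the differentials of the `x i` form a basis, then products of `p`-th powers and monomials
in the `x i` generate the algebra. -/
theorem adjoin_powMonomials_eq_top [Algebra.FiniteType k A] (x : ι → A)
    (b : Module.Basis ι A Ω[A⁄k]) (hb : ∀ i, b i = KaehlerDifferential.D k A (x i)) :
    Algebra.adjoin k (powMonomials p x : Set A) = ⊤ := by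
  nontriviality A
  set C := Algebra.adjoin k (powMonomials p x : Set A)
  have hpow (a : A) : a ^ p ∈ C := Algebra.subset_adjoin (pow_mem_powMonomials p x a)
  have : Algebra.IsIntegral C A := ⟨fun a ↦
    .of_pow (Nat.Prime.pos Fact.out) (isIntegral_algebraMap (x := (⟨a ^ p, hpow a⟩ : C)))⟩
  have : Algebra.FiniteType C A := .of_restrictScalars_finiteType k C A
  have : Module.Finite C A := Algebra.IsIntegral.finite
  have : Algebra.FormallyUnramified C A := by
    refine ⟨subsingleton_of_forall_eq 0 fun ω ↦ ?_⟩
    obtain ⟨η, rfl⟩ := KaehlerDifferential.map_surjective k C A ω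
    suffices KaehlerDifferential.map k C A A = 0 by rw [this, LinearMap.zero_apply]
    refine b.ext fun i ↦ ?_
    rw [hb, KaehlerDifferential.map_D]
    exact (KaehlerDifferential.D C A).map_algebraMap
      ⟨x i, Algebra.subset_adjoin (apply_mem_powMonomials p x i)⟩
  have : CharP C p := charP_of_injective_algebraMap (algebraMap k C).injective p
  refine eq_top_iff.mpr fun a _ ↦ ?_
  obtain ⟨c, rfl⟩ := Algebra.FormallyUnramified.surjective_algebraMap_of_pow_mem_range p
    (C := C) (fun a : A ↦ ⟨⟨a ^ p, hpow a⟩, rfl⟩) a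
  exact c.2

/-- An additive projection onto the part of the algebra killed by the Euler derivations indexed
by `s`. -/
theorem exists_projection_powMonomials (x : ι → A)
    (b : Module.Basis ι A Ω[A⁄k]) (hb : ∀ i, b i = KaehlerDifferential.D k A (x i))
    (s : Finset ι) :
    ∃ E : A →+ A, (∀ a, KaehlerDifferential.D k A a = 0 → E a = a) ∧
      ∀ (a : A) (n : ι → ℕ), E (a ^ p * ∏ j, x j ^ n j) =
        if ∀ i ∈ s, p ∣ n i then a ^ p * ∏ j, x j ^ n j else 0 := by
  classical
  induction s using Finset.induction_on with
  | empty => exact ⟨AddMonoidHom.id A, by simp, by simp⟩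
  | insert i s hi ih =>
    obtain ⟨E, hE0, hE⟩ := ih
    let θ : Module.End k A := (eulerDerivation x b i : A →ₗ[k] A)
    have hp1 : p - 1 ≠ 0 := (Nat.sub_pos_of_lt (Nat.Prime.one_lt Fact.out)).ne'
    refine ⟨E.comp (1 - θ ^ (p - 1) : Module.End k A).toAddMonoidHom, fun a ha ↦ ?_,
      fun a n ↦ ?_⟩
    · have : (θ ^ (p - 1)) a = 0 := by
        obtain ⟨q, hq⟩ := Nat.exists_eq_succ_of_ne_zero hp1
        rw [hq, Nat.succ_eq_add_one, pow_succ, Module.End.mul_apply]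
        simp [θ, eulerDerivation_eq_zero x b i ha]
      simp [this, hE0 a ha]
    · set m := a ^ p * ∏ j, x j ^ n j with hm
      have hθ : θ m = (n i : k) • m := by
        rw [Algebra.smul_def, map_natCast]
        exact eulerDerivation_powMonomial p x b hb i a n
      have hθp (q : ℕ) : (θ ^ q) m = (n i : k) ^ q • m := by
        induction q with
        | zero => simp
        | succ q ihq => rw [pow_succ', Module.End.mul_apply, ihq, map_smul, hθ, smul_smul, pow_succ]
      have hEm := hE a n
      rw [← hm] at hEm
      have hfermat : (n i : k) ^ (p - 1) = if p ∣ n i then 0 else 1 := by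
        split_ifs with hd
        · rw [(CharP.cast_eq_zero_iff k p _).mpr hd, zero_pow hp1]
        · have h1 : (n i : ZMod p) ^ (p - 1) = 1 :=
            ZMod.pow_card_sub_one_eq_one (by rwa [Ne, CharP.cast_eq_zero_iff (ZMod p) p])
          simpa using congrArg (ZMod.castHom (dvd_refl p) k) h1
      by_cases hd : p ∣ n i <;> simp [hθp, hfermat, hd, hEm]

/-- In the presence of coordinates, elements with vanishing differential are `p`-th powers. -/
theorem exists_eq_pow_of_basis_kaehlerDifferential [PerfectField k] [Algebra.FiniteType k A]
    (x : ι → A) (b : Module.Basis ι A Ω[A⁄k])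
    (hb : ∀ i, b i = KaehlerDifferential.D k A (x i))
    {a : A} (ha : KaehlerDifferential.D k A a = 0) : ∃ c : A, a = c ^ p := by
  nontriviality A
  have : CharP A p := charP_of_injective_algebraMap (algebraMap k A).injective p
  obtain ⟨E, hE0, hE⟩ := exists_projection_powMonomials p x b hb Finset.univ
  suffices ∀ y, E y ∈ (frobenius A p).range by
    obtain ⟨c, hc⟩ := this a
    exact ⟨c, by rw [← hE0 a ha, ← hc, frobenius_def]⟩
  intro y
  have hy : y ∈ Submodule.span k (powMonomials p x : Set A) := by
    have := adjoin_powMonomials_eq_top p x b hb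
    rw [← Algebra.toSubmodule_eq_top, Algebra.adjoin_eq_span, Submonoid.closure_eq] at this
    exact this ▸ Submodule.mem_top
  induction hy using Submodule.closure_induction with
  | zero => simp
  | add y z _ _ hy hz => rw [map_add]; exact add_mem hy hz
  | smul_mem r m hm =>
    obtain ⟨c, n, rfl⟩ := hm
    obtain ⟨r, rfl⟩ := surjective_frobenius k p r
    have : frobenius k p r • (c ^ p * ∏ j, x j ^ n j) =
        (algebraMap k A r * c) ^ p * ∏ j, x j ^ n j := by
      rw [Algebra.smul_def, frobenius_def, map_pow]
      ring
    rw [this, hE]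
    split_ifs with hd
    · choose q hq using fun i ↦ hd i (Finset.mem_univ i)
      refine ⟨algebraMap k A r * c * ∏ j, x j ^ q j, ?_⟩
      rw [frobenius_def, mul_pow _ (∏ j, x j ^ q j), ← Finset.prod_pow]
      simp only [hq, ← pow_mul, mul_comm]
    · exact zero_mem _

end Coordinates

/-- Being a `p`-th power is local on a ring of characteristic `p`. -/
theorem exists_eq_pow_of_span_eq_top {A : Type*} [CommRing A] (p : ℕ) [Fact p.Prime] [CharP A p]
    (a : A) (s : Set A) (hs : Ideal.span s = ⊤)
    (h : ∀ f ∈ s, ∃ c : Localization.Away f, algebraMap A _ a = c ^ p) : ∃ c : A, a = c ^ p := by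
  let I : Ideal A :=
    { carrier := {r | r ^ p * a ∈ (frobenius A p).range}
      zero_mem' := ⟨0, by simp [zero_pow (Nat.Prime.ne_zero (Fact.out : p.Prime))]⟩
      add_mem' := fun {r r'} hr hr' ↦ by
        simp only [Set.mem_ofPred_eq, add_pow_char, add_mul] at *
        exact add_mem hr hr'
      smul_mem' := fun r r' hr ↦ by
        simp only [Set.mem_ofPred_eq, smul_eq_mul, mul_pow, mul_assoc] at *
        exact mul_mem ⟨r, rfl⟩ hr }
  suffices I.radical = ⊤ by
    have h1 : (1 : A) ∈ I := I.eq_top_iff_one.mp (Ideal.radical_eq_top.mp this)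
    obtain ⟨c, hc⟩ : (1 : A) ^ p * a ∈ (frobenius A p).range := h1
    exact ⟨c, by simpa [frobenius_def] using hc.symm⟩
  rw [eq_top_iff, ← hs, Ideal.span_le]
  intro f hf
  obtain ⟨c, hc⟩ := h f hf
  obtain ⟨⟨y, ⟨_, n, rfl⟩⟩, hc'⟩ := IsLocalization.surj (Submonoid.powers f) c
  replace hc' : c * algebraMap A (Localization.Away f) (f ^ n) = algebraMap A _ y := hc'
  have hy : algebraMap A (Localization.Away f) ((f ^ n) ^ p * a) = algebraMap A _ (y ^ p) := by
    rw [map_mul, hc, map_pow _ (f ^ n), ← mul_pow, map_pow _ y, ← hc', mul_comm]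
  obtain ⟨⟨_, N, rfl⟩, hN⟩ := (IsLocalization.eq_iff_exists (Submonoid.powers f) _).mp hy
  refine ⟨N + n, f ^ N * y, ?_⟩
  obtain ⟨q, hq⟩ := Nat.exists_eq_succ_of_ne_zero (Nat.Prime.ne_zero (Fact.out : p.Prime))
  simp only at hN
  rw [frobenius_def, mul_pow, pow_add, mul_pow, mul_assoc]
  have hsplit : (f ^ N) ^ p = (f ^ N) ^ q * f ^ N := by rw [hq, pow_succ]
  rw [hsplit, mul_assoc, mul_assoc, hN]

/-- In a smooth algebra over a perfect field of characteristic `p`, elements with vanishing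
differential are `p`-th powers. -/
theorem Algebra.Smooth.exists_eq_pow_of_D_eq_zero {k A : Type*} [Field k] [PerfectField k] (p : ℕ)
    [Fact p.Prime] [CharP k p] [CommRing A] [Algebra k A] [Algebra.Smooth k A] {a : A}
    (ha : KaehlerDifferential.D k A a = 0) : ∃ c : A, a = c ^ p := by
  nontriviality A
  have : CharP A p := charP_of_injective_algebraMap (algebraMap k A).injective p
  obtain ⟨s, hs, hstd⟩ := Algebra.Smooth.exists_span_eq_top_isStandardSmooth k A
  refine exists_eq_pow_of_span_eq_top p a s hs fun f hf ↦ ?_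
  have := hstd f hf
  obtain ⟨-, ι, b, hb⟩ := (Algebra.IsStandardSmooth.iff_exists_basis_kaehlerDifferential
    (R := k) (S := Localization.Away f)).mp this
  choose x hx using fun i ↦ hb (Set.mem_range_self i)
  cases subsingleton_or_nontrivial (Localization.Away f)
  · exact ⟨0, Subsingleton.elim _ _⟩
  have : Finite ι := Module.Finite.finite_basis b
  have := Fintype.ofFinite ι
  refine exists_eq_pow_of_basis_kaehlerDifferential (k := k) p x b (fun i ↦ (hx i).symm) ?_
  rw [← KaehlerDifferential.map_D k k A (Localization.Away f), ha, map_zero]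

/-- **Uniqueness of Kummer data.** Let `k` be a perfect field of characteristic `p` and `A`
a smooth `k`-algebra. If `f` and `g` are units of `A` with `f⁻¹ • df = g⁻¹ • dg` in
`Ω¹_{A/k}`, then `f = h^p * g` for some unit `h` of `A`. -/
theorem dlog_eq_iff_pth_power_unit
    {k A : Type u} [Field k] [PerfectField k] (p : ℕ) [Fact p.Prime] [CharP k p]
    [CommRing A] [Algebra k A] [Algebra.Smooth k A] (f g : Aˣ)
    (h : ((f⁻¹ : Aˣ) : A) • KaehlerDifferential.D k A ((f : Aˣ) : A)
        = ((g⁻¹ : Aˣ) : A) • KaehlerDifferential.D k A ((g : Aˣ) : A)) :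
    ∃ u : Aˣ, f = u ^ p * g := by
  obtain ⟨w, rfl⟩ : ∃ w : Aˣ, f = w * g := ⟨f * g⁻¹, by simp⟩
  have hw : KaehlerDifferential.D k A (w : A) = 0 := by
    rw [Units.val_mul, Derivation.leibniz, smul_add, smul_smul, smul_smul, ← Units.val_mul,
      ← Units.val_mul] at h
    have hw' : w⁻¹ • KaehlerDifferential.D k A (w : A) = 0 := by simpa [← Units.smul_def] using h
    rwa [smul_eq_zero_iff_eq] at hw'
  obtain ⟨c, hc⟩ := Algebra.Smooth.exists_eq_pow_of_D_eq_zero p hw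
  have hcu : IsUnit c :=
    (isUnit_pow_iff (Nat.Prime.ne_zero (Fact.out : p.Prime))).mp (hc ▸ w.isUnit)
  exact ⟨hcu.unit, by congr 1; ext; simp [hc]⟩
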